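/- Let M ≥ 2 be an integer. Then the infimum of the Renyi sensitivities over γ ∈ (0,1)∪(1,∞) is strictly positive: inf_{γ} S(H^R_γ) ≥ ∫_{Δ_{M-1}} -log( max(x_1,…,x_{M-1}, 1-Σ_{i=1}^{M-1} x_i) ) dx > 0. -/

import Mathlib

open MeasureTheory Real Filter Topology

/-- Prelec's probability weighting function: `w(p) = exp(-β(-log p)^α)` for `p ≠ 0`, `w(0) = 0`. -/
noncomputable def prelec (α β p : ℝ) : ℝ :=
  if p = 0 then 0 else Real.exp (-β * (-Real.log p) ^ α)

/-- The simplex `Δ_n = {x ∈ ℝⁿ : xᵢ ≥ 0, ∑ xᵢ ≤ 1}` parametrizing the probability simplex. -/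
def simplexDomain (n : ℕ) : Set (Fin n → ℝ) := {x | (∀ i, 0 ≤ x i) ∧ ∑ i, x i ≤ 1}

/-- Parametrization of the probability simplex `P_M` by `Δ_{M-1}`:
`p = (x_1, …, x_{M-1}, 1 - ∑ x_i)`. -/
noncomputable def simplexParam (M : ℕ) (x : Fin (M - 1) → ℝ) : Fin M → ℝ :=
  fun i => if h : (i : ℕ) < M - 1 then x ⟨(i : ℕ), h⟩ else 1 - ∑ j, x j

/-- The sensitivity `S(H)` of `H : P_M → ℝ`: the Lebesgue integral of `H` over the
parametrized probability simplex. -/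
noncomputable def sens (M : ℕ) (H : (Fin M → ℝ) → ℝ) : ℝ :=
  ∫ x in simplexDomain (M - 1), H (simplexParam M x)

/-- Renyi entropy `H^R_γ(p) = (1/(1-γ)) log (∑ i, p_i^γ)`. -/
noncomputable def renyiEnt (γ : ℝ) {M : ℕ} (p : Fin M → ℝ) : ℝ :=
  (1 / (1 - γ)) * Real.log (∑ i, p i ^ γ)

/-- Min-entropy `-log (max_i p_i)`. -/
noncomputable def minEnt {M : ℕ} (p : Fin M → ℝ) : ℝ := -Real.log (⨆ i, p i)

theorem isCompact_simplexDomain (n : ℕ) : IsCompact (simplexDomain n) := by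
  refine isCompact_Icc.of_isClosed_subset (s := Set.Icc (0 : Fin n → ℝ) 1) ?_ ?_
  · have h : simplexDomain n = (⋂ i, {x | 0 ≤ x i}) ∩ {x | ∑ i, x i ≤ 1} := by
      ext x
      simp [simplexDomain]
    rw [h]
    exact (isClosed_iInter fun i => isClosed_le continuous_const (continuous_apply i)).inter
      (isClosed_le (by fun_prop) continuous_const)
  · rintro x ⟨hx, hs⟩
    exact ⟨hx, fun i =>
      (Finset.single_le_sum (fun j _ => hx j) (Finset.mem_univ i)).trans hs⟩

theorem simplexParam_castSucc {n : ℕ} (x : Fin n → ℝ) (i : Fin n) :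
    simplexParam (n + 1) x i.castSucc = x i := by
  simp [simplexParam]

theorem simplexParam_last {n : ℕ} (x : Fin n → ℝ) :
    simplexParam (n + 1) x (Fin.last n) = 1 - ∑ i, x i := by
  simp [simplexParam]

theorem sum_simplexParam {n : ℕ} (x : Fin n → ℝ) : ∑ i, simplexParam (n + 1) x i = 1 := by
  rw [Fin.sum_univ_castSucc]
  simp only [simplexParam_castSucc, simplexParam_last]
  ring

theorem simplexParam_mem_stdSimplex {n : ℕ} {x : Fin n → ℝ} (hx : x ∈ simplexDomain n) :
    simplexParam (n + 1) x ∈ stdSimplex ℝ (Fin (n + 1)) := by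
  refine ⟨fun i => ?_, sum_simplexParam x⟩
  induction i using Fin.lastCases with
  | last => rw [simplexParam_last]; linarith [hx.2]
  | cast i => rw [simplexParam_castSucc]; exact hx.1 i

theorem continuous_simplexParam (n : ℕ) : Continuous (simplexParam (n + 1)) := by
  refine continuous_pi fun i => ?_
  unfold simplexParam
  split_ifs <;> fun_prop

theorem exists_pos_of_mem_stdSimplex {ι : Type*} [Fintype ι] {p : ι → ℝ}
    (hp : p ∈ stdSimplex ℝ ι) : ∃ i, 0 < p i := by
  by_contra! h
  have := Finset.sum_nonpos fun i (_ : i ∈ Finset.univ) => h i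
  rw [hp.2] at this
  linarith

theorem iSup_pos_of_mem_stdSimplex {ι : Type*} [Fintype ι] {p : ι → ℝ}
    (hp : p ∈ stdSimplex ℝ ι) : 0 < ⨆ i, p i :=
  let ⟨i, hi⟩ := exists_pos_of_mem_stdSimplex hp
  hi.trans_le (le_ciSup (Set.finite_range p).bddAbove i)

theorem sum_rpow_pos_of_mem_stdSimplex {ι : Type*} [Fintype ι] {p : ι → ℝ}
    (hp : p ∈ stdSimplex ℝ ι) (γ : ℝ) : 0 < ∑ i, p i ^ γ :=
  let ⟨i, hi⟩ := exists_pos_of_mem_stdSimplex hp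
  Finset.sum_pos' (fun j _ => rpow_nonneg (hp.1 j) γ)
    ⟨i, Finset.mem_univ i, rpow_pos_of_pos hi γ⟩

/-- The min-entropy is a lower bound for every Renyi entropy. -/
theorem minEnt_le_renyiEnt {M : ℕ} {p : Fin M → ℝ} (hp : p ∈ stdSimplex ℝ (Fin M))
    {γ : ℝ} (h0 : 0 < γ) (h1 : γ ≠ 1) : minEnt p ≤ renyiEnt γ p := by
  have hm := iSup_pos_of_mem_stdSimplex hp
  have hS := sum_rpow_pos_of_mem_stdSimplex hp γ
  have hle : ∀ i, p i ≤ ⨆ i, p i := le_ciSup (Set.finite_range p).bddAbove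
  unfold minEnt renyiEnt
  set m := ⨆ i, p i
  have hsum : ∑ i, p i * m ^ (γ - 1) = m ^ (γ - 1) := by
    rw [← Finset.sum_mul, hp.2, one_mul]
  have hsplit : ∀ i, 0 < p i → p i ^ γ = p i * p i ^ (γ - 1) := fun i hi => by
    rw [rpow_sub_one hi.ne']
    field_simp
  rcases h1.lt_or_gt with h | h
  · have key : m ^ (γ - 1) ≤ ∑ i, p i ^ γ := by
      rw [← hsum]
      refine Finset.sum_le_sum fun i _ => ?_
      rcases (hp.1 i).eq_or_lt with hi | hi
      · rw [← hi, zero_mul, zero_rpow h0.ne']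
      · rw [hsplit i hi]
        exact mul_le_mul_of_nonneg_left
          (rpow_le_rpow_of_nonpos hi (hle i) (by linarith)) hi.le
    have hlog := log_le_log (rpow_pos_of_pos hm _) key
    rw [log_rpow hm] at hlog
    rw [one_div_mul_eq_div, le_div_iff₀ (by linarith)]
    linarith
  · have key : ∑ i, p i ^ γ ≤ m ^ (γ - 1) := by
      rw [← hsum]
      refine Finset.sum_le_sum fun i _ => ?_
      rcases (hp.1 i).eq_or_lt with hi | hi
      · rw [← hi, zero_mul, zero_rpow h0.ne']
      · rw [hsplit i hi]
        exact mul_le_mul_of_nonneg_left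
          (rpow_le_rpow hi.le (hle i) (by linarith)) hi.le
    have hlog := log_le_log hS key
    rw [log_rpow hm] at hlog
    rw [one_div_mul_eq_div, le_div_iff_of_neg (by linarith)]
    linarith

theorem minEnt_nonneg {M : ℕ} {p : Fin M → ℝ} (hp : p ∈ stdSimplex ℝ (Fin M)) :
    0 ≤ minEnt p := by
  obtain ⟨i, -⟩ := exists_pos_of_mem_stdSimplex hp
  have : Nonempty (Fin M) := ⟨i⟩
  refine neg_nonneg.2 (log_nonpos (iSup_pos_of_mem_stdSimplex hp).le (ciSup_le fun j => ?_))
  exact hp.2 ▸ Finset.single_le_sum (fun k _ => hp.1 k) (Finset.mem_univ j)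

theorem minEnt_pos {M : ℕ} (hM : 2 ≤ M) {p : Fin M → ℝ} (hp : ∀ i, 0 < p i)
    (hs : ∑ i, p i = 1) : 0 < minEnt p := by
  have : Nontrivial (Fin M) := Fin.nontrivial_iff_two_le.2 hM
  obtain ⟨i, hi⟩ := exists_eq_ciSup_of_finite (f := p)
  obtain ⟨j, hj⟩ := exists_ne i
  refine neg_pos.2 (log_neg (hi ▸ hp i) ?_)
  rw [← hi, ← hs]
  exact Finset.single_lt_sum hj (Finset.mem_univ i) (Finset.mem_univ j) (hp j)
    fun k _ _ => (hp k).le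

theorem continuousOn_minEnt (n : ℕ) :
    ContinuousOn (minEnt (M := n + 1)) (stdSimplex ℝ (Fin (n + 1))) := by
  refine (ContinuousOn.log ?_ fun p hp => (iSup_pos_of_mem_stdSimplex hp).ne').neg
  simp only [← Finset.sup'_univ_eq_ciSup]
  exact (Continuous.finset_sup'_apply _ fun i _ => continuous_apply i).continuousOn

theorem continuousOn_renyiEnt (M : ℕ) {γ : ℝ} (hγ : 0 < γ) :
    ContinuousOn (renyiEnt γ (M := M)) (stdSimplex ℝ (Fin M)) := by
  refine continuousOn_const.mul (ContinuousOn.log ?_ fun p hp =>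
    (sum_rpow_pos_of_mem_stdSimplex hp γ).ne')
  exact (continuous_finsetSum _ fun i _ =>
    (continuous_apply i).rpow_const fun _ => Or.inr hγ.le).continuousOn

theorem integrableOn_comp_simplexParam {n : ℕ} {H : (Fin (n + 1) → ℝ) → ℝ}
    (hH : ContinuousOn H (stdSimplex ℝ (Fin (n + 1)))) :
    IntegrableOn (fun x : Fin n → ℝ => H (simplexParam (n + 1) x)) (simplexDomain n) :=
  ContinuousOn.integrableOn_compact (isCompact_simplexDomain n)
    (hH.comp (continuous_simplexParam n).continuousOn fun _ hx =>
      simplexParam_mem_stdSimplex hx)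

/-- The parameters of the probability vectors with full support. -/
def openSimplexDomain (n : ℕ) : Set (Fin n → ℝ) := {x | (∀ i, 0 < x i) ∧ ∑ i, x i < 1}

theorem isOpen_openSimplexDomain (n : ℕ) : IsOpen (openSimplexDomain n) := by
  have h : openSimplexDomain n = (⋂ i, {x | 0 < x i}) ∩ {x | ∑ i, x i < 1} := by
    ext x
    simp [openSimplexDomain]
  rw [h]
  exact (isOpen_iInter_of_finite fun i => isOpen_lt continuous_const (continuous_apply i)).inter
    (isOpen_lt (by fun_prop) continuous_const)

theorem openSimplexDomain_nonempty (n : ℕ) : (openSimplexDomain n).Nonempty := by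
  refine ⟨fun _ => 1 / (n + 1 : ℝ), fun _ => by positivity, ?_⟩
  have : (0 : ℝ) < n + 1 := by positivity
  simp only [Finset.sum_const, Finset.card_univ, Fintype.card_fin, nsmul_eq_mul, mul_one_div]
  rw [div_lt_one this]
  linarith

theorem openSimplexDomain_subset (n : ℕ) : openSimplexDomain n ⊆ simplexDomain n :=
  fun _ hx => ⟨fun i => (hx.1 i).le, hx.2.le⟩

theorem simplexParam_pos {n : ℕ} {x : Fin n → ℝ} (hx : x ∈ openSimplexDomain n)
    (i : Fin (n + 1)) : 0 < simplexParam (n + 1) x i := by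
  induction i using Fin.lastCases with
  | last => rw [simplexParam_last]; linarith [hx.2]
  | cast i => rw [simplexParam_castSucc]; exact hx.1 i

/-- The infimum of Renyi sensitivities over `γ ∈ (0,1) ∪ (1,∞)` is at least the integral of
the min-entropy over the simplex, which is strictly positive. -/
theorem inf_sens_renyi_pos (M : ℕ) (hM : 2 ≤ M) :
    sInf ((fun γ : ℝ => sens M (renyiEnt γ)) '' {γ : ℝ | 0 < γ ∧ γ ≠ 1}) ≥
      (∫ x in simplexDomain (M - 1), minEnt (simplexParam M x)) ∧
    0 < ∫ x in simplexDomain (M - 1), minEnt (simplexParam M x) := by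
  obtain ⟨n, rfl⟩ : ∃ n, M = n + 1 := ⟨M - 1, by omega⟩
  change sInf ((fun γ : ℝ => sens (n + 1) (renyiEnt γ)) '' {γ : ℝ | 0 < γ ∧ γ ≠ 1}) ≥
      (∫ x in simplexDomain n, minEnt (simplexParam (n + 1) x)) ∧
    0 < ∫ x in simplexDomain n, minEnt (simplexParam (n + 1) x)
  have hmeas : MeasurableSet (simplexDomain n) := (isCompact_simplexDomain n).measurableSet
  have hint := integrableOn_comp_simplexParam (continuousOn_minEnt n)
  constructor
  · refine le_csInf (Set.Nonempty.image _ ⟨2, by norm_num⟩) ?_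
    rintro _ ⟨γ, ⟨h0, h1⟩, rfl⟩
    exact setIntegral_mono_on hint
      (integrableOn_comp_simplexParam (continuousOn_renyiEnt (n + 1) h0)) hmeas
      fun x hx => minEnt_le_renyiEnt (simplexParam_mem_stdSimplex hx) h0 h1
  · rw [setIntegral_pos_iff_support_of_nonneg_ae ?_ hint]
    · refine ((isOpen_openSimplexDomain n).measure_pos volume
        (openSimplexDomain_nonempty n)).trans_le (measure_mono fun x hx => ?_)
      exact ⟨(minEnt_pos hM (simplexParam_pos hx) (sum_simplexParam x)).ne',
        openSimplexDomain_subset n hx⟩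
    · exact ae_restrict_of_forall_mem hmeas fun x hx =>
        minEnt_nonneg (simplexParam_mem_stdSimplex hx)
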